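/- Let k ≥ 2 and let σ be a derangement of Fin (k+1). Then the coefficient of X^1 in the characteristic polynomial (over ℚ) of the matrix k·I + M_σ − J equals (−1)^k · (1/(k+1)) · Π_{ℓ ∈ cycleType(σ)} (k^ℓ + (−1)^{ℓ+1}). Consequently (by the Matrix Tree Theorem) the number of arborescences of the associated digraph is τ_σ = (1/(k+1)) · Π_{ℓ ∈ cycleType(σ)} (k^ℓ + (−1)^{ℓ+1}). -/

import Mathlib

section Aux
open Equiv Equiv.Perm Matrix

def pM {n : Type*} [DecidableEq n] (σ : Perm n) : Matrix n n ℚ :=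
  Matrix.of fun i j => if σ j = i then (1 : ℚ) else 0

lemma pM_mul {n : Type*} [DecidableEq n] [Fintype n] (σ τ : Perm n) :
    pM (σ * τ) = pM σ * pM τ := by
  ext i j
  simp only [pM, Matrix.mul_apply, Matrix.of_apply, mul_ite, mul_one, mul_zero]
  rw [Finset.sum_ite_eq Finset.univ (τ j)]
  simp
  rfl

lemma pM_one {n : Type*} [DecidableEq n] : pM (1 : Perm n) = 1 := by
  ext i j
  simp [pM, Matrix.one_apply, eq_comm]

lemma pM_disj {n : Type*} [DecidableEq n] [Fintype n] (σ τ : Perm n) (h : Disjoint σ τ) :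
    (pM σ - 1) * (pM τ - 1) = 0 := by
  rw [sub_mul, mul_sub, ← pM_mul, one_mul, mul_one]
  ext i j
  have e : (σ * τ) j = σ (τ j) := rfl
  simp only [pM, Matrix.sub_apply, Matrix.of_apply, Matrix.one_apply, Matrix.zero_apply]
  rcases h j with h1 | h1
  · rcases h (τ j) with h2 | h2
    · simp [h1, h2, eq_comm]
    · simp [τ.injective h2, h1, eq_comm]
  · simp [h1, eq_comm]

lemma det_disj {n : Type*} [DecidableEq n] [Fintype n] (a : ℚ) (σ τ : Perm n)
    (h : Disjoint σ τ) :
    (a + 1) ^ (Fintype.card n) * (a • 1 + pM (σ * τ)).det =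
      (a • 1 + pM σ).det * (a • 1 + pM τ).det := by
  rw [← Matrix.det_smul, ← Matrix.det_mul]
  congr 1
  have h0 := pM_disj σ τ h
  have h1 : pM (σ * τ) = pM σ + pM τ - 1 := by
    rw [pM_mul, ← sub_eq_zero, ← h0]; noncomm_ring
  have h2 : pM σ * pM τ = pM σ + pM τ - 1 := by rw [← pM_mul, h1]
  rw [h1]
  simp only [add_mul, mul_add, smul_mul_assoc, mul_smul_comm, one_mul, mul_one, h2]
  module

lemma perm_eq {n : Type*} [Finite n] (σ τ : Perm n) (hs : IsCycle σ)
    (h : ∀ i, τ i = i ∨ τ i = σ i) : τ = 1 ∨ τ = σ := by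
  by_cases ht : τ = 1
  · exact Or.inl ht
  right
  obtain ⟨i, hi⟩ : ∃ i, τ i ≠ i := by
    by_contra! hc
    exact ht (Equiv.ext hc)
  have hsi : σ i ≠ i := by
    rcases h i with h1 | h1
    · exact absurd h1 hi
    · rwa [← h1]
  have key : ∀ j, τ j ≠ j → τ (σ j) ≠ σ j := by
    intro j hj hc
    rcases h j with h1 | h1
    · exact hj h1
    · rw [← h1] at hc
      exact hj (τ.injective hc)
  have kn : ∀ m : ℕ, τ ((σ ^ m) i) ≠ (σ ^ m) i := by
    intro m
    induction m with
    | zero => simpa using hi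
    | succ m ih => rw [pow_succ', Perm.mul_apply]; exact key _ ih
  ext j
  rcases h j with h1 | h1
  · by_cases hj : σ j = j
    · rw [h1, hj]
    · exfalso
      obtain ⟨m, rfl⟩ := hs.exists_pow_eq hsi hj
      exact kn m h1
  · exact h1

lemma det_cycle {n : Type*} [DecidableEq n] [Fintype n] (a : ℚ) (σ : Perm n) (hs : IsCycle σ) :
    (a • 1 + pM σ).det = (a + 1) ^ (Fintype.card n - σ.support.card) *
      (a ^ σ.support.card + (-1) ^ (σ.support.card + 1)) := by
  rw [Matrix.det_apply', ← Finset.sum_subset (Finset.subset_univ {1, σ})]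
  · rw [Finset.sum_pair hs.ne_one.symm, hs.sign]
    have e1 : ∏ i, (a • (1 : Matrix n n ℚ) + pM σ) ((1 : Perm n) i) i =
        (a + 1) ^ (Fintype.card n - σ.support.card) * a ^ σ.support.card := by
      rw [← Finset.prod_compl_mul_prod σ.support, ← Finset.card_compl]
      congr 1
      · apply Finset.prod_eq_pow_card
        intro i hi
        simp at hi
        simp [pM, hi]
      · apply Finset.prod_eq_pow_card
        intro i hi
        simp at hi
        simp [pM, hi]
    have e2 : ∏ i, (a • (1 : Matrix n n ℚ) + pM σ) (σ i) i =
        (a + 1) ^ (Fintype.card n - σ.support.card) := by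
      rw [← Finset.prod_compl_mul_prod σ.support, ← Finset.card_compl]
      rw [Finset.prod_eq_one (s := σ.support), mul_one]
      · apply Finset.prod_eq_pow_card
        intro i hi
        simp at hi
        simp [pM, hi]
      · intro i hi
        simp at hi
        simp [pM, hi]
    rw [e1, e2]
    simp
    ring
  · intro τ _ ht
    have : ∃ i, τ i ≠ i ∧ τ i ≠ σ i := by
      by_contra! hc
      apply ht
      have := perm_eq σ τ hs (fun i => or_iff_not_imp_left.2 (hc i))
      simpa using this
    obtain ⟨i, h1, h2⟩ := this
    rw [Finset.prod_eq_zero (Finset.mem_univ i), mul_zero]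
    simp [pM, h1, h2.symm]

lemma det_gen {n : Type*} [DecidableEq n] [Fintype n] (a : ℚ) (ha : a + 1 ≠ 0) (σ : Perm n) :
    (a • 1 + pM σ).det = (a + 1) ^ (Fintype.card n) *
      (σ.cycleType.map fun ℓ => (a ^ ℓ + (-1) ^ (ℓ + 1)) / (a + 1) ^ ℓ).prod := by
  induction σ using cycle_induction_on with
  | base_one =>
    have : a • (1 : Matrix n n ℚ) + 1 = (a + 1) • 1 := by module
    rw [pM_one, this]; simp
  | base_cycles σ hs =>
    rw [det_cycle a σ hs, hs.cycleType, pow_sub₀ _ ha (Finset.card_le_univ _)]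
    simp
    ring
  | induction_disjoint σ τ hd hc h1 h2 =>
    have := det_disj a σ τ hd
    rw [h1, h2] at this
    have hp : (a + 1) ^ (Fintype.card n) ≠ 0 := pow_ne_zero _ ha
    apply mul_left_cancel₀ hp
    rw [this, hd.cycleType_mul, Multiset.map_add, Multiset.prod_add]
    ring

open Polynomial in
lemma charpoly_rel (k : ℕ) (C : Matrix (Fin (k + 1)) (Fin (k + 1)) ℚ)
    (hC : ∀ i, ∑ j, C i j = (k : ℚ) + 1) :
    (X - Polynomial.C ((k : ℚ) + 1)) * (C - Matrix.of fun _ _ => (1 : ℚ)).charpoly =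
      X * C.charpoly := by
  have hne : (X - Polynomial.C ((k : ℚ) + 1)) ^ k ≠ 0 := pow_ne_zero _ (X_sub_C_ne_zero _)
  apply mul_left_cancel₀ hne
  apply Polynomial.funext
  intro t
  simp only [eval_mul, eval_pow, eval_sub, eval_X, eval_C, Matrix.eval_charpoly]
  set J : Matrix (Fin (k + 1)) (Fin (k + 1)) ℚ := Matrix.of fun _ _ => (1 : ℚ) with hJ
  have hCJ : C * J = ((k : ℚ) + 1) • J := by
    ext i j
    simp [Matrix.mul_apply, hJ, hC]
  have h1 : ((t - ((k : ℚ) + 1)) • (1 : Matrix (Fin (k + 1)) (Fin (k + 1)) ℚ) + J).det =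
      (t - ((k : ℚ) + 1)) ^ k * t := by
    have := congrArg (Polynomial.eval (t - ((k : ℚ) + 1)))
      (Matrix.charpoly_vecMulVec (fun _ : Fin (k + 1) => (-1 : ℚ)) (fun _ => 1))
    rw [Matrix.eval_charpoly] at this
    convert this using 1
    · congr 1
      ext i j
      simp [Matrix.vecMulVec, hJ, Matrix.scalar_apply, Matrix.one_apply, Matrix.diagonal_apply]
    · simp [dotProduct]
      ring
  have h2 : (t - ((k : ℚ) + 1)) • (Matrix.scalar (Fin (k + 1)) t - (C - J)) =
      (Matrix.scalar (Fin (k + 1)) t - C) * ((t - ((k : ℚ) + 1)) • 1 + J) := by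
    have hs : Matrix.scalar (Fin (k + 1)) t = t • (1 : Matrix (Fin (k + 1)) (Fin (k + 1)) ℚ) := by
      ext i j
      simp [Matrix.scalar_apply, Matrix.one_apply, Matrix.diagonal_apply]
    rw [hs, mul_add, sub_mul _ _ J, hCJ]
    simp only [smul_mul_assoc, mul_smul_comm, one_mul, mul_one]
    module
  have h3 := congrArg Matrix.det h2
  rw [Matrix.det_smul, Matrix.det_mul, h1, Fintype.card_fin] at h3
  linear_combination h3

theorem simplex_aux (k : ℕ) (hk : 2 ≤ k)
    (σ : Equiv.Perm (Fin (k + 1))) (hσ : ∀ j, σ j ≠ j) :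
    (Matrix.charpoly
        ((k : ℚ) • (1 : Matrix (Fin (k + 1)) (Fin (k + 1)) ℚ) +
          (Matrix.of fun i j => if σ j = i then (1 : ℚ) else 0) -
          Matrix.of fun _ _ => (1 : ℚ))).coeff 1 =
      (-1 : ℚ) ^ k * (1 / ((k : ℚ) + 1)) *
        (σ.cycleType.map fun ℓ => (k : ℚ) ^ ℓ + (-1 : ℚ) ^ (ℓ + 1)).prod := by
  have hk0 : (k : ℚ) + 1 ≠ 0 := by positivity
  change (Matrix.charpoly ((k : ℚ) • 1 + pM σ - Matrix.of fun _ _ => (1 : ℚ))).coeff 1 = _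
  have hrel := charpoly_rel k ((k : ℚ) • 1 + pM σ) (by
    intro i
    simp only [Matrix.add_apply, Finset.sum_add_distrib, Matrix.smul_apply, Matrix.one_apply, pM,
      Matrix.of_apply, ← Equiv.eq_symm_apply]
    simp)
  have hdet := Matrix.det_eq_sign_charpoly_coeff ((k : ℚ) • 1 + pM σ)
  have hg := det_gen (k : ℚ) hk0 σ
  have hsup : σ.support = Finset.univ := by
    ext i
    simp [hσ i]
  have hsum : σ.cycleType.sum = k + 1 := by rw [sum_cycleType, hsup]; simp
  rw [Multiset.prod_map_div] at hg
  have hpow : (σ.cycleType.map fun ℓ => ((k : ℚ) + 1) ^ ℓ).prod = ((k : ℚ) + 1) ^ (k + 1) := by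
    generalize σ.cycleType = s at hsum
    generalize hm : k + 1 = m at hsum ⊢
    generalize (k : ℚ) + 1 = c
    clear * - hsum
    subst hsum
    induction s using Multiset.induction_on with
    | empty => simp
    | cons a s ih => simp [ih, pow_add]
  change _ = _ * (_ / (σ.cycleType.map fun ℓ => ((k : ℚ) + 1) ^ ℓ).prod) at hg
  rw [hpow, Fintype.card_fin, mul_div_cancel₀ _ (pow_ne_zero _ hk0)] at hg
  rw [← hg, hdet, Fintype.card_fin]
  set B := Matrix.charpoly ((k : ℚ) • 1 + pM σ - Matrix.of fun _ _ => (1 : ℚ)) with hB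
  set D := Matrix.charpoly ((k : ℚ) • 1 + pM σ) with hD
  have c0 := congrArg (fun p => Polynomial.coeff p 0) hrel
  have c1 := congrArg (fun p => Polynomial.coeff p 1) hrel
  simp only [sub_mul, Polynomial.coeff_sub, Polynomial.coeff_C_mul, Polynomial.coeff_X_mul,
    Polynomial.coeff_X_mul_zero] at c0 c1
  have b0 : B.coeff 0 = 0 := by
    have : ((k : ℚ) + 1) * B.coeff 0 = 0 := by linarith
    simpa [hk0] using this
  rw [b0] at c1
  have hs : (-1 : ℚ) ^ k * (-1) ^ k = 1 := by rw [← mul_pow]; simp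
  field_simp
  rw [pow_succ]
  linear_combination (-1) * c1 + D.coeff 0 * hs

end Aux


/-- For a derangement `σ` of `Fin (k+1)`, the coefficient of `X^1` in the characteristic
polynomial of `k·I + M_σ - J` equals
`(-1)^k · (1/(k+1)) · ∏_{ℓ ∈ cycleType σ} (k^ℓ + (-1)^{ℓ+1})`; by the Matrix Tree Theorem
this gives the number of arborescences `τ_σ` of the associated digraph. -/
theorem coeff_one_charpoly_simplex_laplacian (k : ℕ) (hk : 2 ≤ k)
    (σ : Equiv.Perm (Fin (k + 1))) (hσ : ∀ j, σ j ≠ j) :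
    (Matrix.charpoly
        ((k : ℚ) • (1 : Matrix (Fin (k + 1)) (Fin (k + 1)) ℚ) +
          (Matrix.of fun i j => if σ j = i then (1 : ℚ) else 0) -
          Matrix.of fun _ _ => (1 : ℚ))).coeff 1 =
      (-1 : ℚ) ^ k * (1 / ((k : ℚ) + 1)) *
        (σ.cycleType.map fun ℓ => (k : ℚ) ^ ℓ + (-1 : ℚ) ^ (ℓ + 1)).prod :=
  simplex_aux k hk σ hσ
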